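/- Let n ≥ 1 be an integer and let u_0, u_1, …, u_n be real numbers. Then the n-th Adomian polynomial of the exponential nonlinearity N(u) = e^u satisfies A_n(u_0, u_1, …, u_n) = (e^{u_0}/n!) · B_n(1!·u_1, 2!·u_2, …, n!·u_n); that is, (1/n!)·(d/dλ)^n exp(u_0 + u_1 λ + ⋯ + u_n λ^n) evaluated at λ = 0 equals (e^{u_0}/n!) · B_n(1!·u_1, 2!·u_2, …, n!·u_n). -/

import Mathlib

/-- The partition set `Λ^k_n` as a finset: functions `ℕ → ℕ` supported on `{1, …, n-k+1}`
with `k_1 + ⋯ + k_{n-k+1} = k` and `1·k_1 + 2·k_2 + ⋯ + (n-k+1)·k_{n-k+1} = n`. -/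
def lambdaSet (n k : ℕ) : Finset (ℕ → ℕ) :=
  (Finset.piAntidiag (Finset.Icc 1 (n - k + 1)) k).filter
    (fun v => ∑ j ∈ Finset.Icc 1 (n - k + 1), j * v j = n)

/-- The partial exponential Bell polynomial
`B_{n,k}(u_1, …, u_{n-k+1}) = n! Σ_{Λ^k_n} Π_j (1/k_j!) (u_j/j!)^{k_j}`. -/
noncomputable def bellB (n k : ℕ) (u : ℕ → ℝ) : ℝ :=
  (Nat.factorial n : ℝ) * ∑ v ∈ lambdaSet n k, ∏ j ∈ Finset.Icc 1 (n - k + 1),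
    (1 / (Nat.factorial (v j) : ℝ)) * (u j / (Nat.factorial j : ℝ)) ^ (v j)

/-- The partial ordinary Bell polynomial
`B̂_{n,k}(u_1, …, u_{n-k+1}) = k! Σ_{Λ^k_n} Π_j u_j^{k_j}/k_j!`. -/
noncomputable def bellBhat (n k : ℕ) (u : ℕ → ℝ) : ℝ :=
  (Nat.factorial k : ℝ) * ∑ v ∈ lambdaSet n k, ∏ j ∈ Finset.Icc 1 (n - k + 1),
    (u j) ^ (v j) / (Nat.factorial (v j) : ℝ)

/-- The `n`-th complete exponential Bell polynomial
`B_n(u_1, …, u_n) = Σ_{k=1}^{n} B_{n,k}(u_1, …, u_{n-k+1})`, with the convention `B_0 = 1`. -/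
noncomputable def completeBellB (n : ℕ) (u : ℕ → ℝ) : ℝ :=
  if n = 0 then 1 else ∑ k ∈ Finset.Icc 1 n, bellB n k u

open Polynomial in
/-- The derivative of a truncated exponential series in a polynomial. -/
lemma derivative_sum_pow_div_factorial (P : ℝ[X]) (n : ℕ) :
    derivative (∑ k ∈ Finset.range (n + 1), C (1 / (k.factorial : ℝ)) * P ^ k) +
        C (1 / (n.factorial : ℝ)) * P ^ n * derivative P =
      (∑ k ∈ Finset.range (n + 1), C (1 / (k.factorial : ℝ)) * P ^ k) * derivative P := by
  induction n with
  | zero => simp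
  | succ n ih =>
    have h : C (1 / ((n + 1).factorial : ℝ)) * C ((n : ℝ) + 1) = C (1 / (n.factorial : ℝ)) := by
      rw [← C_mul, Nat.factorial_succ]
      congr 1
      push_cast
      field_simp
    rw [Finset.sum_range_succ, derivative_add, derivative_C_mul, derivative_pow_succ, add_mul,
      ← ih, ← h]
    ring

open Polynomial in
/-- If `P` has no constant term, the first `n` Taylor coefficients of `Q * exp P` at zero are those
of the polynomial obtained by truncating the exponential series at order `n`. -/
lemma iteratedDeriv_eval_mul_exp_eval (P : ℝ[X]) (hP : P.coeff 0 = 0) (n : ℕ) {m : ℕ} (hm : m ≤ n)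
    (Q : ℝ[X]) :
    iteratedDeriv m (fun x : ℝ => Q.eval x * Real.exp (P.eval x)) 0 =
      (m.factorial : ℝ) *
        (Q * ∑ k ∈ Finset.range (n + 1), C (1 / (k.factorial : ℝ)) * P ^ k).coeff m := by
  induction m generalizing Q with
  | zero =>
    rw [coeff_zero_eq_eval_zero] at hP
    simp [coeff_zero_eq_eval_zero, hP, Finset.sum_range_succ', eval_finsetSum]
  | succ m ih =>
    have hd : deriv (fun x : ℝ => Q.eval x * Real.exp (P.eval x)) =
        fun x => (derivative Q + Q * derivative P).eval x * Real.exp (P.eval x) := by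
      funext x
      refine ((Q.hasDerivAt x).mul (P.hasDerivAt x).exp).deriv.trans ?_
      simp only [eval_add, eval_mul]
      ring
    have hX : (Q * (C (1 / (n.factorial : ℝ)) * P ^ n * derivative P)).coeff m = 0 := by
      have hdvd : X ^ n ∣ Q * (C (1 / (n.factorial : ℝ)) * P ^ n * derivative P) :=
        ((pow_dvd_pow_of_dvd (X_dvd_iff.mpr hP) n).mul_left _).mul_right _ |>.mul_left _
      exact X_pow_dvd_iff.mp hdvd m hm
    rw [iteratedDeriv_succ', hd, ih (by lia)]
    have hS := derivative_sum_pow_div_factorial P n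
    set S := ∑ k ∈ Finset.range (n + 1), C (1 / (k.factorial : ℝ)) * P ^ k
    have hc : (derivative Q + Q * derivative P) * S =
        derivative (Q * S) + Q * (C (1 / (n.factorial : ℝ)) * P ^ n * derivative P) := by
      rw [derivative_mul]
      linear_combination (-Q) * hS
    rw [hc, coeff_add, hX, add_zero, coeff_derivative, Nat.factorial_succ]
    push_cast
    ring

/-- `Λ^k_n` does not change when indices up to `n` are allowed. -/
lemma lambdaSet_eq_filter_piAntidiag {n k : ℕ} (hk : 1 ≤ k) (hkn : k ≤ n) :
    lambdaSet n k = (Finset.piAntidiag (Finset.Icc 1 n) k).filter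
      (fun v => ∑ j ∈ Finset.Icc 1 n, j * v j = n) := by
  have hsub : Finset.Icc 1 (n - k + 1) ⊆ Finset.Icc 1 n :=
    Finset.Icc_subset_Icc le_rfl (by lia)
  ext v
  simp only [lambdaSet, Finset.mem_filter, Finset.mem_piAntidiag]
  constructor
  · rintro ⟨⟨h1, h2⟩, h3⟩
    have hz : ∀ j ∈ Finset.Icc 1 n, j ∉ Finset.Icc 1 (n - k + 1) → v j = 0 :=
      fun j _ hj => by_contra fun h => hj (h2 j h)
    refine ⟨⟨?_, fun j hj => hsub (h2 j hj)⟩, ?_⟩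
    · rw [← h1, Finset.sum_subset hsub hz]
    · rw [← Finset.sum_subset hsub fun j hj hj' => by rw [hz j hj hj', mul_zero], h3]
  · rintro ⟨⟨h1, h2⟩, h3⟩
    have hs : ∀ j, v j ≠ 0 → j ∈ Finset.Icc 1 (n - k + 1) := by
      intro j hj
      have hjn := h2 j hj
      have hsplit : ∑ i ∈ Finset.Icc 1 n, i * v i =
          ∑ i ∈ Finset.Icc 1 n, (i - 1) * v i + ∑ i ∈ Finset.Icc 1 n, v i := by
        rw [← Finset.sum_add_distrib]
        refine Finset.sum_congr rfl fun i hi => ?_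
        obtain ⟨i, rfl⟩ := Nat.exists_eq_add_of_le' (Finset.mem_Icc.mp hi).1
        simp [add_mul]
      have hle : (j - 1) * v j ≤ ∑ i ∈ Finset.Icc 1 n, (i - 1) * v i :=
        Finset.single_le_sum (f := fun i => (i - 1) * v i) (fun _ _ => Nat.zero_le _) hjn
      have hle' : j - 1 ≤ (j - 1) * v j := Nat.le_mul_of_pos_right _ (Nat.pos_of_ne_zero hj)
      have := (Finset.mem_Icc.mp hjn).1
      rw [Finset.mem_Icc]
      lia
    have hz : ∀ j ∈ Finset.Icc 1 n, j ∉ Finset.Icc 1 (n - k + 1) → v j = 0 :=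
      fun j _ hj => by_contra fun h => hj (hs j h)
    refine ⟨⟨?_, hs⟩, ?_⟩
    · rw [Finset.sum_subset hsub hz]
      exact h1
    · rw [Finset.sum_subset hsub fun j hj hj' => by rw [hz j hj hj', mul_zero], h3]

open Polynomial in
/-- Partial Bell polynomials as coefficients of powers of a generating polynomial. -/
lemma bellB_factorial_mul {n k : ℕ} (hk : 1 ≤ k) (hkn : k ≤ n) (u : ℕ → ℝ) :
    bellB n k (fun j => (j.factorial : ℝ) * u j) =
      (n.factorial : ℝ) *
        (C (1 / (k.factorial : ℝ)) * (∑ i ∈ Finset.Icc 1 n, C (u i) * X ^ i) ^ k).coeff n := by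
  have hsub : Finset.Icc 1 (n - k + 1) ⊆ Finset.Icc 1 n :=
    Finset.Icc_subset_Icc le_rfl (by lia)
  have hprod : ∀ v ∈ lambdaSet n k, ∏ j ∈ Finset.Icc 1 (n - k + 1),
      (1 / ((v j).factorial : ℝ)) * ((j.factorial : ℝ) * u j / (j.factorial : ℝ)) ^ v j =
      ∏ j ∈ Finset.Icc 1 n, (1 / ((v j).factorial : ℝ)) * u j ^ v j := by
    intro v hv
    simp only [lambdaSet, Finset.mem_filter, Finset.mem_piAntidiag] at hv
    rw [← Finset.prod_subset hsub fun j _ hj => by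
      rw [show v j = 0 from by_contra fun h => hj (hv.1.2 j h)]; simp]
    refine Finset.prod_congr rfl fun j _ => ?_
    rw [mul_div_cancel_left₀ _ (Nat.cast_ne_zero.mpr j.factorial_ne_zero)]
  rw [bellB, Finset.sum_congr rfl hprod, lambdaSet_eq_filter_piAntidiag hk hkn, coeff_C_mul,
    Finset.sum_pow_eq_sum_piAntidiag, finsetSum_coeff, Finset.sum_filter]
  congr 1
  rw [Finset.mul_sum]
  refine Finset.sum_congr rfl fun v hv => ?_
  have hv' := (Finset.mem_piAntidiag.mp hv).1
  have hmon : ∏ i ∈ Finset.Icc 1 n, (C (u i) * X ^ i) ^ v i =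
      C (∏ i ∈ Finset.Icc 1 n, u i ^ v i) * X ^ (∑ i ∈ Finset.Icc 1 n, i * v i) := by
    simp only [mul_pow, Finset.prod_mul_distrib, ← pow_mul, Finset.prod_pow_eq_pow_sum, map_prod,
      map_pow]
  have hmul : (∏ i ∈ Finset.Icc 1 n, ((v i).factorial : ℝ)) *
      (Nat.multinomial (Finset.Icc 1 n) v : ℝ) = (k.factorial : ℝ) := by
    have h := Nat.multinomial_spec (Finset.Icc 1 n) v
    rw [hv'] at h
    exact_mod_cast h
  have hne : (∏ i ∈ Finset.Icc 1 n, ((v i).factorial : ℝ)) ≠ 0 :=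
    Finset.prod_ne_zero_iff.mpr fun i _ => Nat.cast_ne_zero.mpr (v i).factorial_ne_zero
  have hk0 : (k.factorial : ℝ) ≠ 0 := Nat.cast_ne_zero.mpr k.factorial_ne_zero
  rw [hmon, ← C_eq_natCast, coeff_C_mul, coeff_C_mul, coeff_X_pow]
  simp only [eq_comm (a := n)]
  split_ifs
  · rw [Finset.prod_mul_distrib, Finset.prod_div_distrib, Finset.prod_const_one, ← hmul]
    rw [← hmul] at hk0
    have := right_ne_zero_of_mul hk0
    field_simp
  · simp

/-- For `n ≥ 1`, the `n`-th Adomian polynomial of the exponential nonlinearity `N(u) = e^u`,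
i.e. `(1/n!)·(d/dλ)^n exp(u_0 + u_1 λ + ⋯ + u_n λ^n)|_{λ=0}`, equals
`(e^{u_0}/n!)·B_n(1!·u_1, 2!·u_2, …, n!·u_n)`. -/
theorem adomian_exp_eq_completeBell (n : ℕ) (hn : 1 ≤ n) (u : ℕ → ℝ) :
    (1 / (Nat.factorial n : ℝ)) *
      iteratedDeriv n
        (fun l : ℝ => Real.exp (∑ i ∈ Finset.range (n + 1), u i * l ^ i)) 0 =
    (Real.exp (u 0) / (Nat.factorial n : ℝ)) *
      completeBellB n (fun j => (Nat.factorial j : ℝ) * u j) := by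
  have hn0 : n ≠ 0 := by lia
  set P : Polynomial ℝ := ∑ i ∈ Finset.Icc 1 n, Polynomial.C (u i) * Polynomial.X ^ i with hPdef
  have hP : P.coeff 0 = 0 := by
    rw [hPdef, Polynomial.finsetSum_coeff]
    refine Finset.sum_eq_zero fun i hi => ?_
    have := (Finset.mem_Icc.mp hi).1
    rw [Polynomial.coeff_C_mul, Polynomial.coeff_X_pow, if_neg (by lia), mul_zero]
  have hfun : (fun l : ℝ => Real.exp (∑ i ∈ Finset.range (n + 1), u i * l ^ i)) =
      fun l => Real.exp (u 0) * ((1 : Polynomial ℝ).eval l * Real.exp (P.eval l)) := by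
    funext l
    rw [Polynomial.eval_one, one_mul, ← Real.exp_add, hPdef, Polynomial.eval_finsetSum,
      Finset.range_eq_Ico, Finset.sum_eq_sum_Ico_succ_bot n.add_one_pos]
    simp [Finset.Ico_add_one_right_eq_Icc]
  have hsum : completeBellB n (fun j => (Nat.factorial j : ℝ) * u j) =
      (n.factorial : ℝ) * (1 * ∑ k ∈ Finset.range (n + 1),
        Polynomial.C (1 / (k.factorial : ℝ)) * P ^ k).coeff n := by
    rw [completeBellB, if_neg hn0, one_mul, Polynomial.finsetSum_coeff, Finset.range_eq_Ico,
      Finset.sum_eq_sum_Ico_succ_bot n.add_one_pos, zero_add,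
      Finset.Ico_add_one_right_eq_Icc, mul_add, Finset.mul_sum,
      Finset.sum_congr rfl fun k hk =>
        bellB_factorial_mul (Finset.mem_Icc.mp hk).1 (Finset.mem_Icc.mp hk).2 u]
    simp [Polynomial.coeff_one, hn0, ← hPdef]
  rw [hfun, iteratedDeriv_const_mul_field, iteratedDeriv_eval_mul_exp_eval P hP n le_rfl, hsum]
  ring
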